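/- Let E ⊆ [0,1]² be symmetric. The space C_E is a first-countable continuum: it is compact, Hausdorff, connected, and every point of C_E has a countable neighborhood basis. -/

import Mathlib

open Set Filter Topology TopologicalSpace

noncomputable section

/-- The underlying set of the connected comb `C`: the unit square `[0,1] × [0,1]`. -/
def Comb : Type := unitInterval × unitInterval

namespace Comb

/-- `mk x y` is the point `(x, y)` of the comb. -/
def mk (x y : unitInterval) : Comb := (x, y)

/-- The prescribed basic neighbourhoods `U(x,y,n)`:
for `y = 0` it is `(((x − 2⁻ⁿ, x + 2⁻ⁿ) ∩ [0,1]) × [0,1]) \ ({x} × [2⁻ⁿ, 1])`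
(the intersections with `[0,1]` are automatic since coordinates are in `unitInterval`),
and for `y > 0` it is `{x} × ((y − 2⁻ⁿ, y + 2⁻ⁿ) ∩ [0,1])`. -/
def U (p : Comb) (n : ℕ) : Set Comb :=
  if (p.2 : ℝ) = 0 then
    {q : Comb | (q.1 : ℝ) ∈ Set.Ioo ((p.1 : ℝ) - 2 ^ (-(n : ℤ))) ((p.1 : ℝ) + 2 ^ (-(n : ℤ)))} \
      {q : Comb | q.1 = p.1 ∧ (q.2 : ℝ) ∈ Set.Icc ((2 : ℝ) ^ (-(n : ℤ))) 1}
  else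
    {q : Comb | q.1 = p.1 ∧
      (q.2 : ℝ) ∈ Set.Ioo ((p.2 : ℝ) - 2 ^ (-(n : ℤ))) ((p.2 : ℝ) + 2 ^ (-(n : ℤ)))}

/-- The neighbourhood filter at `p` generated by the basic neighbourhoods `U p n`. -/
def nhdsFun (p : Comb) : Filter Comb := ⨅ n : ℕ, 𝓟 (U p n)

/-- The comb topology: the topology determined by the prescribed neighbourhood bases
(a set is open iff it is a neighbourhood, in the sense of the prescribed bases,
of each of its points). -/
instance : TopologicalSpace Comb := TopologicalSpace.mkOfNhds nhdsFun

end Comb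

namespace Comb

/-- The cross-shaped set `D_{x,a} = ({x} × [a,1] × C) ∪ (C × {x} × [a,1]) ⊆ C × C`. -/
def Dset (x : unitInterval) (a : ℝ) : Set (Comb × Comb) :=
  {p : Comb × Comb | p.1.1 = x ∧ (p.1.2 : ℝ) ∈ Set.Icc a 1} ∪
  {p : Comb × Comb | p.2.1 = x ∧ (p.2.2 : ℝ) ∈ Set.Icc a 1}

/-- A subset `E` of the unit square is symmetric if `(x,y) ∈ E ↔ (y,x) ∈ E` for all `x, y`. -/
def SymmSet (E : Set (unitInterval × unitInterval)) : Prop :=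
  ∀ x y : unitInterval, (x, y) ∈ E ↔ (y, x) ∈ E

/-- The open set `⋃_{(x,y) ∉ E} ({x} × (0,1]) × ({y} × (0,1])` that is removed from `C × C`. -/
def removedSet (E : Set (unitInterval × unitInterval)) : Set (Comb × Comb) :=
  ⋃ q ∈ Eᶜ, {p : Comb × Comb | p.1.1 = q.1 ∧ (p.1.2 : ℝ) ∈ Set.Ioc 0 1 ∧
    p.2.1 = q.2 ∧ (p.2.2 : ℝ) ∈ Set.Ioc 0 1}

/-- The space `C_E`: the complement in `C × C` of the removed set. -/
def CE (E : Set (unitInterval × unitInterval)) : Set (Comb × Comb) := (removedSet E)ᶜ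

/-- `D^E_{x,a} = D_{x,a} ∩ C_E`. -/
def DE (E : Set (unitInterval × unitInterval)) (x : unitInterval) (a : ℝ) :
    Set (Comb × Comb) := Dset x a ∩ CE E

/-- The base square `S = {(x,0,y,0) : x, y ∈ [0,1]}` of `C × C`. -/
def baseSquare : Set (Comb × Comb) :=
  {p : Comb × Comb | (p.1.2 : ℝ) = 0 ∧ (p.2.2 : ℝ) = 0}

end Comb

namespace Comb

/-- The height function of the tooth over `t`: it is `y` at `(t, y)` and vanishes off the
tooth. -/
def height (t : unitInterval) (q : Comb) : ℝ := if q.1 = t then (q.2 : ℝ) else 0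

/-- The comb, viewed as a subset of `[0,1] × ℝ^[0,1]`. -/
def embed (q : Comb) : unitInterval × (unitInterval → ℝ) := (q.1, fun t => height t q)

theorem height_nonneg (t : unitInterval) (q : Comb) : 0 ≤ height t q := by
  unfold height
  split_ifs
  · exact q.2.2.1
  · exact le_rfl

theorem height_le_one (t : unitInterval) (q : Comb) : height t q ≤ 1 := by
  unfold height
  split_ifs
  · exact q.2.2.2
  · exact zero_le_one

theorem height_self (q : Comb) : height q.1 q = q.2 := if_pos rfl

theorem height_of_ne {t : unitInterval} {q : Comb} (h : q.1 ≠ t) : height t q = 0 := if_neg h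

theorem height_pos_iff {t : unitInterval} {q : Comb} :
    0 < height t q ↔ q.1 = t ∧ (q.2 : ℝ) ∈ Ioc 0 1 := by
  unfold height
  split_ifs with h
  · exact ⟨fun hq => ⟨h, hq, q.2.2.2⟩, fun hq => hq.2.1⟩
  · simp [h]

theorem embed_injective : Function.Injective embed := by
  intro p q h
  have h1 : p.1 = q.1 := congrArg (fun z => z.1) h
  have h2 : height p.1 p = height p.1 q := congrArg (fun z => z.2 p.1) h
  rw [height_self, h1, height_self] at h2
  exact Prod.ext h1 (Subtype.ext h2)

theorem range_embed : range embed =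
    {z | (∀ t, z.2 t ∈ Icc (0 : ℝ) 1) ∧ ∀ t, z.1 = t ∨ z.2 t = 0} := by
  ext ⟨x, f⟩
  constructor
  · rintro ⟨q, hq⟩
    rw [← hq]
    exact ⟨fun t => ⟨height_nonneg t q, height_le_one t q⟩,
      fun t => or_iff_not_imp_left.2 fun h => height_of_ne h⟩
  · rintro ⟨h1, h2⟩
    refine ⟨mk x ⟨f x, h1 x⟩, Prod.ext rfl (funext fun t => ?_)⟩
    by_cases h : x = t
    · subst h
      exact height_self _
    · exact (height_of_ne h).trans ((h2 t).resolve_left h).symm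

theorem isCompact_range_embed : IsCompact (range embed) := by
  have hK : IsCompact
      ((univ : Set unitInterval) ×ˢ (univ : Set unitInterval).pi fun _ => Icc (0 : ℝ) 1) :=
    isCompact_univ.prod (isCompact_univ_pi fun _ => isCompact_Icc)
  refine hK.of_isClosed_subset ?_ ?_
  · rw [range_embed]
    simp only [ofPred_and, ofPred_forall, ofPred_or]
    refine (isClosed_iInter fun t => isClosed_Icc.preimage (by fun_prop)).inter
      (isClosed_iInter fun t => (isClosed_eq (by fun_prop) (by fun_prop)).union
        (isClosed_eq (by fun_prop) (by fun_prop)))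
  · rw [range_embed]
    exact fun z hz => ⟨mem_univ _, fun t _ => hz.1 t⟩

theorem mem_U_of_eq_zero {p : Comb} (hp : (p.2 : ℝ) = 0) {n : ℕ} {q : Comb} :
    q ∈ U p n ↔ |(q.1 : ℝ) - p.1| < 2⁻¹ ^ n ∧ height p.1 q < 2⁻¹ ^ n := by
  have e : (2 : ℝ) ^ (-(n : ℤ)) = 2⁻¹ ^ n := by simp
  have hpos : (0 : ℝ) < 2⁻¹ ^ n := by positivity
  rw [U, if_pos hp, e, abs_sub_lt_iff]
  simp only [Set.mem_sdiff, mem_ofPred_eq, mem_Ioo, mem_Icc, not_and, height]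
  have hq := q.2.2.2
  constructor
  · rintro ⟨⟨h1, h2⟩, h3⟩
    refine ⟨⟨by linarith, by linarith⟩, ?_⟩
    split_ifs with h
    · by_contra! h4
      exact h3 h h4 hq
    · exact hpos
  · rintro ⟨⟨h1, h2⟩, h3⟩
    refine ⟨⟨by linarith, by linarith⟩, fun h h4 => ?_⟩
    rw [if_pos h] at h3
    linarith

theorem mem_U_of_ne_zero {p : Comb} (hp : (p.2 : ℝ) ≠ 0) {n : ℕ} {q : Comb} :
    q ∈ U p n ↔ q.1 = p.1 ∧ |(q.2 : ℝ) - p.2| < 2⁻¹ ^ n := by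
  have e : (2 : ℝ) ^ (-(n : ℤ)) = 2⁻¹ ^ n := by simp
  rw [U, if_neg hp, e, abs_sub_lt_iff]
  simp only [mem_ofPred_eq, mem_Ioo]
  constructor
  · rintro ⟨h, h1, h2⟩
    exact ⟨h, by linarith, by linarith⟩
  · rintro ⟨h, h1, h2⟩
    exact ⟨h, by linarith, by linarith⟩

theorem U_mem_nhdsFun (p : Comb) (n : ℕ) : U p n ∈ nhdsFun p :=
  mem_iInf_of_mem n (mem_principal_self _)

theorem eventually_nhdsFun_of_pow {p : Comb} {P : Comb → Prop} {ε : ℝ} (hε : 0 < ε)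
    (h : ∀ n : ℕ, (2⁻¹ : ℝ) ^ n < ε → ∀ q ∈ U p n, P q) : ∀ᶠ q in nhdsFun p, P q := by
  obtain ⟨n, hn⟩ := exists_pow_lt_of_lt_one hε (by norm_num : (2⁻¹ : ℝ) < 1)
  exact mem_of_superset (U_mem_nhdsFun p n) (h n hn)

theorem tendsto_fst_nhdsFun (p : Comb) :
    Tendsto (fun q : Comb => q.1) (nhdsFun p) (𝓝 p.1) := by
  refine Metric.tendsto_nhds.2 fun ε hε => eventually_nhdsFun_of_pow hε fun n hn q hq => ?_
  by_cases hp : (p.2 : ℝ) = 0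
  · exact ((mem_U_of_eq_zero hp).1 hq).1.trans hn
  · rw [((mem_U_of_ne_zero hp).1 hq).1, dist_self]
    exact hε

theorem tendsto_height_nhdsFun (p : Comb) (t : unitInterval) :
    Tendsto (height t) (nhdsFun p) (𝓝 (height t p)) := by
  refine Metric.tendsto_nhds.2 fun ε hε => ?_
  by_cases hp : (p.2 : ℝ) = 0
  · by_cases ht : p.1 = t
    · subst ht
      refine eventually_nhdsFun_of_pow hε fun n hn q hq => ?_
      rw [height_self, hp, Real.dist_eq, sub_zero, abs_of_nonneg (height_nonneg _ _)]
      exact ((mem_U_of_eq_zero hp).1 hq).2.trans hn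
    · refine eventually_nhdsFun_of_pow (dist_pos.2 ht) fun n hn q hq => ?_
      have hqt : q.1 ≠ t := by
        rintro rfl
        have h := ((mem_U_of_eq_zero hp).1 hq).1.trans hn
        rw [dist_comm] at h
        exact lt_irrefl _ h
      rw [height_of_ne ht, height_of_ne hqt, dist_self]
      exact hε
  · refine eventually_nhdsFun_of_pow hε fun n hn q hq => ?_
    obtain ⟨h1, h2⟩ := (mem_U_of_ne_zero hp).1 hq
    by_cases ht : p.1 = t
    · subst ht
      rw [height_self, height, if_pos h1, Real.dist_eq]
      exact h2.trans hn
    · rw [height_of_ne ht, height_of_ne (h1 ▸ ht), dist_self]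
      exact hε

theorem comap_embed_nhds (p : Comb) : comap embed (𝓝 (embed p)) = nhdsFun p := by
  apply le_antisymm
  · have hfst : Tendsto (fun q : Comb => (q.1 : ℝ)) (comap embed (𝓝 (embed p))) (𝓝 p.1) :=
      ((continuous_subtype_val.comp continuous_fst).tendsto (embed p)).comp tendsto_comap
    have hheight (t : unitInterval) :
        Tendsto (height t) (comap embed (𝓝 (embed p))) (𝓝 (height t p)) :=
      (((continuous_apply t).comp continuous_snd).tendsto (embed p)).comp tendsto_comap
    refine le_iInf fun n => le_principal_iff.2 ?_
    have hpos : (0 : ℝ) < 2⁻¹ ^ n := by positivity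
    by_cases hp : (p.2 : ℝ) = 0
    · have h0 : height p.1 p < 2⁻¹ ^ n := by rwa [height_self, hp]
      filter_upwards [Metric.tendsto_nhds.1 hfst _ hpos, (hheight p.1).eventually_lt_const h0]
        with q h1 h2
      exact (mem_U_of_eq_zero hp).2 ⟨h1, h2⟩
    · have h0 : 0 < height p.1 p := by
        rw [height_self]
        exact lt_of_le_of_ne p.2.2.1 (Ne.symm hp)
      filter_upwards [Metric.tendsto_nhds.1 (hheight p.1) _ hpos,
        (hheight p.1).eventually_const_lt h0] with q h1 h2
      have hq := (height_pos_iff.1 h2).1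
      rw [height_self, ← hq, height_self] at h1
      exact (mem_U_of_ne_zero hp).2 ⟨hq, h1⟩
  · refine tendsto_iff_comap.1 ?_
    exact (tendsto_fst_nhdsFun p).prodMk_nhds
      (tendsto_pi_nhds.2 fun t => tendsto_height_nhdsFun p t)

theorem isInducing_embed : IsInducing embed := by
  refine ⟨TopologicalSpace.ext_iff.2 fun s => ?_⟩
  let τ : TopologicalSpace Comb := induced embed inferInstance
  change _ ↔ IsOpen[τ] s
  rw [@isOpen_iff_mem_nhds _ τ s]
  simp only [τ, nhds_induced, comap_embed_nhds]
  rfl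

theorem nhds_eq_nhdsFun (p : Comb) : 𝓝 p = nhdsFun p := by
  rw [isInducing_embed.nhds_eq_comap, comap_embed_nhds]

instance : T2Space Comb := (IsEmbedding.mk isInducing_embed embed_injective).t2Space

instance : CompactSpace Comb :=
  ⟨isInducing_embed.isCompact_iff.2 (by rw [image_univ]; exact isCompact_range_embed)⟩

instance : FirstCountableTopology Comb :=
  ⟨fun p => by rw [nhds_eq_nhdsFun, nhdsFun]; infer_instance⟩

theorem continuous_height (t : unitInterval) : Continuous (height t) :=
  ((continuous_apply t).comp continuous_snd).comp isInducing_embed.continuous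

theorem continuous_mk_right (x : unitInterval) : Continuous (mk x) := by
  refine isInducing_embed.continuous_iff.2 (continuous_const.prodMk (continuous_pi fun t => ?_))
  by_cases h : x = t
  · exact continuous_subtype_val.congr fun y => (if_pos h).symm
  · exact continuous_const.congr fun y => (if_neg h).symm

theorem continuous_mk_zero : Continuous fun x => mk x 0 := by
  refine isInducing_embed.continuous_iff.2 (continuous_id.prodMk (continuous_pi fun t => ?_))
  refine (continuous_const (y := (0 : ℝ))).congr fun x => ?_
  change 0 = if x = t then (0 : ℝ) else 0
  rw [ite_self]

theorem mem_CE_iff_height {E : Set (unitInterval × unitInterval)} {z : Comb × Comb} :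
    z ∈ CE E ↔ ∀ q ∈ Eᶜ, height q.1 z.1 ≤ 0 ∨ height q.2 z.2 ≤ 0 := by
  simp only [CE, removedSet, mem_compl_iff, mem_iUnion, mem_ofPred_eq, not_exists]
  refine forall₂_congr fun q _ => ?_
  rw [← not_lt, ← not_lt, ← not_and_or, height_pos_iff, height_pos_iff, and_assoc]

theorem mem_CE_iff {E : Set (unitInterval × unitInterval)} {z : Comb × Comb} :
    z ∈ CE E ↔ (z.1.1, z.2.1) ∈ E ∨ z.1.2 = 0 ∨ z.2.2 = 0 := by
  rw [mem_CE_iff_height]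
  constructor
  · intro h
    refine or_iff_not_imp_left.2 fun hz => ?_
    have := h _ hz
    simp only [height_self] at this
    exact this.imp (fun h => Subtype.ext (le_antisymm h z.1.2.2.1))
      fun h => Subtype.ext (le_antisymm h z.2.2.2.1)
  · rintro h ⟨s, t⟩ hst
    by_contra! hpos
    obtain ⟨h1, h2, -⟩ := height_pos_iff.1 hpos.1
    obtain ⟨h3, h4, -⟩ := height_pos_iff.1 hpos.2
    rcases h with h | h | h
    · exact hst (by simpa [h1, h3] using h)
    · simp [h] at h2
    · simp [h] at h4

theorem isClosed_CE (E : Set (unitInterval × unitInterval)) : IsClosed (CE E) := by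
  have : CE E = ⋂ q ∈ Eᶜ, {z : Comb × Comb | height q.1 z.1 ≤ 0 ∨ height q.2 z.2 ≤ 0} := by
    ext z
    rw [mem_CE_iff_height]
    simp only [mem_iInter, mem_ofPred_eq]
  rw [this]
  exact isClosed_biInter fun q _ =>
    (isClosed_le ((continuous_height q.1).comp continuous_fst) continuous_const).union
      (isClosed_le ((continuous_height q.2).comp continuous_snd) continuous_const)

theorem isConnected_CE (E : Set (unitInterval × unitInterval)) : IsConnected (CE E) := by
  have hbase (x y : unitInterval) : (mk x 0, mk y 0) ∈ CE E := mem_CE_iff.2 (Or.inr (Or.inl rfl))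
  refine ⟨⟨_, hbase 0 0⟩, isPreconnected_of_forall (mk 0 0, mk 0 0) fun z hz => ?_⟩
  let f (s : unitInterval) : Comb × Comb := (mk z.1.1 (s * z.1.2), mk z.2.1 (s * z.2.2))
  let g (xy : unitInterval × unitInterval) : Comb × Comb := (mk xy.1 0, mk xy.2 0)
  have hf : Continuous f :=
    ((continuous_mk_right _).comp (continuous_id.mul continuous_const)).prodMk
      ((continuous_mk_right _).comp (continuous_id.mul continuous_const))
  have hg : Continuous g :=
    (continuous_mk_zero.comp continuous_fst).prodMk (continuous_mk_zero.comp continuous_snd)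
  have hf1 : f 1 = z := by
    simp only [f, one_mul]
    rfl
  refine ⟨range g ∪ range f, union_subset ?_ ?_, Or.inl ⟨(0, 0), rfl⟩, Or.inr ⟨1, hf1⟩,
    (isPreconnected_range hg).union (g (z.1.1, z.2.1)) ⟨_, rfl⟩ ⟨0, ?_⟩ (isPreconnected_range hf)⟩
  · rintro _ ⟨xy, rfl⟩
    exact hbase _ _
  · rintro _ ⟨s, rfl⟩
    refine mem_CE_iff.2 ((mem_CE_iff.1 hz).imp id (Or.imp (fun h => ?_) fun h => ?_))
    · change s * z.1.2 = 0
      rw [h, mul_zero]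
    · change s * z.2.2 = 0
      rw [h, mul_zero]
  · simp only [f, g, zero_mul]

end Comb

/-- Let `E ⊆ [0,1]²` be symmetric. The space `C_E` is a first-countable
continuum: compact, Hausdorff, connected, and every point has a countable
neighbourhood basis. -/
theorem CE_firstCountable_continuum (E : Set (unitInterval × unitInterval))
    (hE : Comb.SymmSet E) :
    CompactSpace ↥(Comb.CE E) ∧ T2Space ↥(Comb.CE E) ∧ ConnectedSpace ↥(Comb.CE E) ∧
      FirstCountableTopology ↥(Comb.CE E) := by
  have := isCompact_iff_compactSpace.1 (Comb.isClosed_CE E).isCompact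
  exact ⟨this, inferInstance, isConnected_iff_connectedSpace.1 (Comb.isConnected_CE E),
    inferInstance⟩
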